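/- Ink-spots theorem with leakage: there exist constants c ∈ (0,1) and C > 0, depending only on d and s, such that the following holds. Let μ ∈ (0,1), m ≥ 1, r₀ > 0, and let E ⊆ F be bounded Lebesgue measurable subsets of ℝ × ℝ^d × ℝ^d such that (i) E ⊆ Q₁, and (ii) every slanted kinetic cylinder Q = Q_r(z₀) with Q ⊆ Q₁ and |Q ∩ E| ≥ (1−μ)|Q| satisfies both Q̄^m(z₀,r) ⊆ F and r < r₀. Then |E| ≤ ((m+1)/m)(1 − cμ)( |F ∩ Q₁| + C m r₀^{2s} ). -/

import Mathlib

open MeasureTheory Metric Set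

noncomputable section

/-- Kinetic phase space `ℝ × ℝ^d × ℝ^d` with variables `z = (t, x, v)`. -/
abbrev Phase (d : ℕ) := ℝ × EuclideanSpace ℝ (Fin d) × EuclideanSpace ℝ (Fin d)

/-- The slanted kinetic cylinder `Q_r(z₀)` of radius `r` centered at `z₀ = (t₀,x₀,v₀)`. -/
def kinCyl (d : ℕ) (s : ℝ) (z₀ : Phase d) (r : ℝ) : Set (Phase d) :=
  {z | z₀.1 - r ^ (2 * s) < z.1 ∧ z.1 ≤ z₀.1 ∧ dist z.2.2 z₀.2.2 < r ∧
       ‖z.2.1 - z₀.2.1 - (z.1 - z₀.1) • z₀.2.2‖ < r ^ (1 + 2 * s)}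

/-- The unit cylinder `Q₁ = (-1,0] × B₁ × B₁` centered at the origin. -/
def unitCyl (d : ℕ) (s : ℝ) : Set (Phase d) := kinCyl d s (0 : Phase d) 1

/-- The stacked (time-delayed) cylinder `Q̄^m(z₀, r)` associated with `Q_r(z₀)`. -/
def kinCylStack (d : ℕ) (s m : ℝ) (z₀ : Phase d) (r : ℝ) : Set (Phase d) :=
  {z | 0 < z.1 - z₀.1 ∧ z.1 - z₀.1 ≤ m * r ^ (2 * s) ∧ dist z.2.2 z₀.2.2 < r ∧
       ‖z.2.1 - z₀.2.1 - (z.1 - z₀.1) • z₀.2.2‖ < (m + 2) * r ^ (1 + 2 * s)}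

abbrev VSp (d : ℕ) := EuclideanSpace ℝ (Fin d)

/-- Generic slanted product set. -/
def slab (d : ℕ) (z₀ : Phase d) (I : Set ℝ) (A B : Set (VSp d)) : Set (Phase d) :=
  {z | z.1 ∈ I ∧ z.2.1 - z₀.2.1 - (z.1 - z₀.1) • z₀.2.2 ∈ A ∧ z.2.2 ∈ B}

lemma slab_meas (d : ℕ) (z₀ : Phase d) {I : Set ℝ} {A B : Set (VSp d)}
    (hI : MeasurableSet I) (hA : MeasurableSet A) (hB : MeasurableSet B) :
    MeasurableSet (slab d z₀ I A B) := by
  have h1 : Measurable (fun z : Phase d => z.1) := measurable_fst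
  have h2 : Measurable (fun z : Phase d => z.2.1 - z₀.2.1 - (z.1 - z₀.1) • z₀.2.2) := by
    apply Continuous.measurable; fun_prop
  have h3 : Measurable (fun z : Phase d => z.2.2) := by fun_prop
  exact (h1 hI).inter ((h2 hA).inter (h3 hB))

lemma slab_open (d : ℕ) (z₀ : Phase d) {I : Set ℝ} {A B : Set (VSp d)}
    (hI : IsOpen I) (hA : IsOpen A) (hB : IsOpen B) :
    IsOpen (slab d z₀ I A B) := by
  have h1 : Continuous (fun z : Phase d => z.1) := continuous_fst
  have h2 : Continuous (fun z : Phase d => z.2.1 - z₀.2.1 - (z.1 - z₀.1) • z₀.2.2) := by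
    fun_prop
  have h3 : Continuous (fun z : Phase d => z.2.2) := by fun_prop
  exact (hI.preimage h1).inter ((hA.preimage h2).inter (hB.preimage h3))

lemma slab_vol (d : ℕ) (z₀ : Phase d) {I : Set ℝ} {A B : Set (VSp d)}
    (hI : MeasurableSet I) (hA : MeasurableSet A) (hB : MeasurableSet B) :
    volume (slab d z₀ I A B) = volume I * (volume A * volume B) := by
  have key : volume (slab d z₀ I A B) =
      ∫⁻ t : ℝ, I.indicator (fun _ => volume A * volume B) t := by
    rw [show (volume : Measure (Phase d)) = (volume : Measure ℝ).prod volume from rfl,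
      Measure.prod_apply (slab_meas d z₀ hI hA hB)]
    refine lintegral_congr fun t => ?_
    by_cases ht : t ∈ I
    · rw [Set.indicator_of_mem ht]
      have : Prod.mk t ⁻¹' slab d z₀ I A B =
          ((fun x : VSp d => x + (-(z₀.2.1 + (t - z₀.1) • z₀.2.2))) ⁻¹' A) ×ˢ B := by
        ext ⟨x, v⟩
        simp only [slab, Set.mem_preimage, Set.mem_ofPred_eq, ht, true_and, Set.mem_prod]
        rw [show x - z₀.2.1 - (t - z₀.1) • z₀.2.2 =
          x + (-(z₀.2.1 + (t - z₀.1) • z₀.2.2)) by abel]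
      rw [this, show (volume : Measure (VSp d × VSp d)) = (volume : Measure (VSp d)).prod volume
        from rfl, Measure.prod_prod, measure_preimage_add_right]
    · rw [Set.indicator_of_notMem ht]
      have : Prod.mk t ⁻¹' slab d z₀ I A B = ∅ := by
        ext ⟨x, v⟩
        simp [slab, ht]
      rw [this, measure_empty]
  rw [key, lintegral_indicator hI, setLIntegral_const, mul_comm]

/-- Fubini along the free flow. -/
lemma shear_vol (d : ℕ) {S : Set (Phase d)} (hS : MeasurableSet S) :
    volume S = ∫⁻ v : VSp d, ∫⁻ y : VSp d, volume {t : ℝ | (t, y + t • v, v) ∈ S} := by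
  have hf : Measurable (S.indicator (1 : Phase d → ENNReal)) := measurable_one.indicator hS
  have e1 : volume S = ∫⁻ t : ℝ, ∫⁻ x : VSp d, ∫⁻ v : VSp d,
      S.indicator (1 : Phase d → ENNReal) (t, x, v) := by
    rw [← lintegral_indicator_one hS,
      show (volume : Measure (Phase d)) = (volume : Measure ℝ).prod volume from rfl,
      lintegral_prod _ hf.aemeasurable]
    refine lintegral_congr fun t => ?_
    rw [show (volume : Measure (VSp d × VSp d)) = (volume : Measure (VSp d)).prod volume
        from rfl, lintegral_prod]
    exact (hf.comp measurable_prodMk_left).aemeasurable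
  have e2 : ∀ t : ℝ, ∫⁻ x : VSp d, ∫⁻ v : VSp d, S.indicator (1 : Phase d → ENNReal) (t, x, v) =
      ∫⁻ v : VSp d, ∫⁻ y : VSp d, S.indicator (1 : Phase d → ENNReal) (t, y + t • v, v) := by
    intro t
    rw [lintegral_lintegral_swap]
    · refine lintegral_congr fun v => ?_
      exact (lintegral_add_right_eq_self
        (fun x => S.indicator (1 : Phase d → ENNReal) (t, x, v)) (t • v)).symm
    · exact (hf.comp measurable_prodMk_left).aemeasurable
  rw [e1]
  simp_rw [e2]
  have hg : Measurable (fun p : ℝ × VSp d × VSp d =>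
      S.indicator (1 : Phase d → ENNReal) (p.1, p.2.2 + p.1 • p.2.1, p.2.1)) := by
    apply hf.comp
    apply Continuous.measurable
    fun_prop
  rw [lintegral_lintegral_swap]
  · refine lintegral_congr fun v => ?_
    rw [lintegral_lintegral_swap]
    · refine lintegral_congr fun y => ?_
      have hm : MeasurableSet {t : ℝ | (t, y + t • v, v) ∈ S} := by
        have : Measurable (fun t : ℝ => ((t, y + t • v, v) : Phase d)) := by
          apply Continuous.measurable; fun_prop
        exact this hS
      rw [← lintegral_indicator_one hm]
      rfl
    · have h : Measurable (fun q : ℝ × VSp d => ((q.1, v, q.2) : ℝ × VSp d × VSp d)) := by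
        fun_prop
      exact (hg.comp h).aemeasurable
  · have h : Measurable (Function.uncurry fun (t : ℝ) (v : VSp d) => ∫⁻ y : VSp d,
        S.indicator (1 : Phase d → ENNReal) (t, y + t • v, v)) := by
      have h' : Measurable (fun q : (ℝ × VSp d) × VSp d =>
          S.indicator (1 : Phase d → ENNReal) (q.1.1, q.2 + q.1.1 • q.1.2, q.1.2)) := by
        have h : Measurable (fun q : (ℝ × VSp d) × VSp d =>
          ((q.1.1, q.1.2, q.2) : ℝ × VSp d × VSp d)) := by fun_prop
        exact hg.comp h
      exact h'.lintegral_prod_right'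
    exact h.aemeasurable

/-- One-dimensional finite merging lemma. -/
lemma oneD_finite (m : ℝ) (hm : 0 < m) : ∀ (n : ℕ) (S : Finset (ℝ × ℝ)), S.card ≤ n →
    (∀ p ∈ S, p.1 < p.2) →
    volume (⋃ p ∈ S, Ioc (p.1 - (p.2 - p.1) / m) p.2) ≤
      ENNReal.ofReal ((m + 1) / m) * volume (⋃ p ∈ S, Ioc p.1 p.2) := by
  classical
  intro n
  induction n with
  | zero =>
    intro S hS _
    rw [Nat.le_zero, Finset.card_eq_zero] at hS
    subst hS
    simp
  | succ n ih =>
    intro S hS hlt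
    by_cases hdisj : (S : Set (ℝ × ℝ)).PairwiseDisjoint (fun p => Ioc p.1 p.2)
    · calc volume (⋃ p ∈ S, Ioc (p.1 - (p.2 - p.1) / m) p.2)
          ≤ ∑ p ∈ S, volume (Ioc (p.1 - (p.2 - p.1) / m) p.2) := measure_biUnion_finset_le _ _
        _ = ∑ p ∈ S, ENNReal.ofReal ((m + 1) / m) * volume (Ioc p.1 p.2) := by
            refine Finset.sum_congr rfl fun p hp => ?_
            rw [Real.volume_Ioc, Real.volume_Ioc, ← ENNReal.ofReal_mul (by positivity)]
            congr 1
            field_simp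
            ring
        _ = ENNReal.ofReal ((m + 1) / m) * volume (⋃ p ∈ S, Ioc p.1 p.2) := by
            rw [measure_biUnion_finset hdisj (fun p _ => measurableSet_Ioc), Finset.mul_sum]
    · simp only [Set.PairwiseDisjoint, Set.Pairwise, not_forall] at hdisj
      obtain ⟨p, hp, q, hq, hpq, hnd⟩ := hdisj
      simp only [Function.onFun, Set.not_disjoint_iff] at hnd
      obtain ⟨x, ⟨hx1, hx2⟩, ⟨hx3, hx4⟩⟩ := hnd
      have hp' := hlt p hp
      have hq' := hlt q hq
      set w : ℝ × ℝ := (min p.1 q.1, max p.2 q.2) with hw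
      set S' := (S.erase p).erase q with hS'
      have hc : (insert w S').card ≤ n := by
        refine (Finset.card_insert_le _ _).trans ?_
        rw [hS', Finset.card_erase_of_mem (Finset.mem_erase.2 ⟨Ne.symm hpq, hq⟩),
          Finset.card_erase_of_mem hp]
        have : 1 < S.card := Finset.one_lt_card.2 ⟨p, hp, q, hq, hpq⟩
        omega
      have hwlt : ∀ a ∈ insert w S', a.1 < a.2 := by
        intro a ha
        rcases Finset.mem_insert.1 ha with rfl | ha
        · exact lt_of_le_of_lt (min_le_left _ _) (lt_of_lt_of_le hp' (le_max_left _ _))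
        · exact hlt a (Finset.mem_of_mem_erase (Finset.mem_of_mem_erase ha))
      have hext : ∀ a : ℝ × ℝ, w.1 ≤ a.1 → a.2 ≤ w.2 →
          Ioc (a.1 - (a.2 - a.1) / m) a.2 ⊆ Ioc (w.1 - (w.2 - w.1) / m) w.2 := by
        intro a h1 h2
        apply Ioc_subset_Ioc _ h2
        have : (a.2 - a.1) / m ≤ (w.2 - w.1) / m := by gcongr
        linarith
      calc volume (⋃ a ∈ S, Ioc (a.1 - (a.2 - a.1) / m) a.2)
          ≤ volume (⋃ a ∈ insert w S', Ioc (a.1 - (a.2 - a.1) / m) a.2) := by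
            apply measure_mono
            apply Set.iUnion₂_subset
            intro a ha
            by_cases h : a = p ∨ a = q
            · have h1 : w.1 ≤ a.1 := by rcases h with rfl | rfl <;> simp [hw]
              have h2 : a.2 ≤ w.2 := by rcases h with rfl | rfl <;> simp [hw]
              refine (hext a h1 h2).trans ?_
              exact Set.subset_biUnion_of_mem (u := fun a : ℝ × ℝ =>
                Ioc (a.1 - (a.2 - a.1) / m) a.2) (Finset.mem_insert_self w S')
            · push Not at h
              exact Set.subset_biUnion_of_mem (u := fun a : ℝ × ℝ =>
                Ioc (a.1 - (a.2 - a.1) / m) a.2) (Finset.mem_insert_of_mem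
                  (Finset.mem_erase.2 ⟨h.2, Finset.mem_erase.2 ⟨h.1, ha⟩⟩))
        _ ≤ ENNReal.ofReal ((m + 1) / m) * volume (⋃ a ∈ insert w S', Ioc a.1 a.2) :=
            ih _ hc hwlt
        _ ≤ ENNReal.ofReal ((m + 1) / m) * volume (⋃ a ∈ S, Ioc a.1 a.2) := by
            refine mul_le_mul' le_rfl (measure_mono ?_)
            apply Set.iUnion₂_subset
            intro a ha
            rcases Finset.mem_insert.1 ha with rfl | ha
            · intro y hy
              simp only [hw, Set.mem_Ioc, min_lt_iff, le_max_iff] at hy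
              have : y ∈ Ioc p.1 p.2 ∨ y ∈ Ioc q.1 q.2 := by
                simp only [Set.mem_Ioc]
                rcases le_total y x with hyx | hyx
                · rcases hy.1 with h | h
                  · exact Or.inl ⟨h, by linarith⟩
                  · exact Or.inr ⟨h, by linarith⟩
                · rcases hy.2 with h | h
                  · exact Or.inl ⟨by linarith, h⟩
                  · exact Or.inr ⟨by linarith, h⟩
              rcases this with h | h
              · exact Set.mem_biUnion (t := fun a : ℝ × ℝ => Ioc a.1 a.2) hp h
              · exact Set.mem_biUnion (t := fun a : ℝ × ℝ => Ioc a.1 a.2) hq h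
            · exact Set.subset_biUnion_of_mem (u := fun a : ℝ × ℝ => Ioc a.1 a.2)
                (Finset.mem_of_mem_erase (Finset.mem_of_mem_erase ha))

/-- One-dimensional delayed-interval lemma. -/
lemma oneD (m : ℝ) (hm : 0 < m) {ι : Type*} (T : Set ι) (a h : ι → ℝ) (hh : ∀ i ∈ T, 0 < h i)
    (U W : Set ℝ) (hU : IsOpen U) (hUT : U ⊆ ⋃ i ∈ T, Ioo (a i - h i) (a i))
    (hW : ∀ i ∈ T, Ioc (a i) (a i + m * h i) ⊆ W) :
    volume U ≤ ENNReal.ofReal ((m + 1) / m) * volume W := by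
  classical
  rw [hU.measure_eq_iSup_isCompact]
  refine iSup₂_le fun K hKU => iSup_le fun hK => ?_
  obtain ⟨b, hbT, hbf, hKb⟩ := hK.elim_finite_subcover_image (b := T)
    (c := fun i => Ioo (a i - h i) (a i)) (fun i _ => isOpen_Ioo) (hKU.trans hUT)
  let S : Finset (ℝ × ℝ) := hbf.toFinset.image (fun i => (a i, a i + m * h i))
  calc volume K ≤ volume (⋃ p ∈ S, Ioc (p.1 - (p.2 - p.1) / m) p.2) := by
        apply measure_mono
        refine hKb.trans (Set.iUnion₂_subset fun i hi => ?_)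
        have hi' : (a i, a i + m * h i) ∈ S :=
          Finset.mem_image_of_mem _ (hbf.mem_toFinset.2 hi)
        refine Set.Subset.trans ?_ (Set.subset_biUnion_of_mem (u := fun p : ℝ × ℝ =>
                Ioc (p.1 - (p.2 - p.1) / m) p.2) hi')
        intro y hy
        have h0 := hh i (hbT hi)
        have : m * h i / m = h i := by field_simp
        refine ⟨?_, ?_⟩
        · simp only [add_sub_cancel_left, this]
          exact hy.1
        · have : 0 < m * h i := by positivity
          have := hy.2
          simp only
          linarith
    _ ≤ ENNReal.ofReal ((m + 1) / m) * volume (⋃ p ∈ S, Ioc p.1 p.2) := by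
        refine oneD_finite m hm _ S le_rfl ?_
        intro p hp
        obtain ⟨i, hi, rfl⟩ := Finset.mem_image.1 hp
        have h0 := hh i (hbT (hbf.mem_toFinset.1 hi))
        have : 0 < m * h i := by positivity
        simp only
        linarith
    _ ≤ ENNReal.ofReal ((m + 1) / m) * volume W := by
        refine mul_le_mul' le_rfl (measure_mono ?_)
        refine Set.iUnion₂_subset fun p hp => ?_
        obtain ⟨i, hi, rfl⟩ := Finset.mem_image.1 hp
        exact hW i (hbT (hbf.mem_toFinset.1 hi))

/-- Open-in-time version of the kinetic cylinder. -/
def ocyl (d : ℕ) (s : ℝ) (z₀ : Phase d) (r : ℝ) : Set (Phase d) :=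
  slab d z₀ (Ioo (z₀.1 - r ^ (2 * s)) z₀.1) (ball 0 (r ^ (1 + 2 * s))) (ball z₀.2.2 r)

/-- Enlarged cylinder. -/
def encyl (d : ℕ) (s : ℝ) (z₀ : Phase d) (r : ℝ) : Set (Phase d) :=
  slab d z₀ (Ioo (z₀.1 - 29 * r ^ (2 * s)) (z₀.1 + 29 * r ^ (2 * s)))
    (ball 0 (29 * r ^ (1 + 2 * s))) (ball z₀.2.2 (29 * r))

lemma kinCyl_eq_slab (d : ℕ) (s : ℝ) (z₀ : Phase d) (r : ℝ) :
    kinCyl d s z₀ r =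
      slab d z₀ (Ioc (z₀.1 - r ^ (2 * s)) z₀.1) (ball 0 (r ^ (1 + 2 * s))) (ball z₀.2.2 r) := by
  ext z
  simp only [kinCyl, slab, Set.mem_ofPred_eq, Set.mem_Ioc, Metric.mem_ball, dist_zero_right]
  tauto

lemma mem_ocyl (d : ℕ) (s : ℝ) (z₀ : Phase d) (r : ℝ) (z : Phase d) :
    z ∈ ocyl d s z₀ r ↔ (z₀.1 - r ^ (2 * s) < z.1 ∧ z.1 < z₀.1) ∧
      ‖z.2.1 - z₀.2.1 - (z.1 - z₀.1) • z₀.2.2‖ < r ^ (1 + 2 * s) ∧ dist z.2.2 z₀.2.2 < r := by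
  simp only [ocyl, slab, Set.mem_ofPred_eq, Set.mem_Ioo, Metric.mem_ball, dist_zero_right]

lemma ocyl_sub (d : ℕ) (s : ℝ) (z₀ : Phase d) (r : ℝ) : ocyl d s z₀ r ⊆ kinCyl d s z₀ r := by
  intro z hz
  rw [mem_ocyl] at hz
  exact ⟨hz.1.1, hz.1.2.le, hz.2.2, hz.2.1⟩

lemma ocyl_open (d : ℕ) (s : ℝ) (z₀ : Phase d) (r : ℝ) : IsOpen (ocyl d s z₀ r) :=
  slab_open d z₀ isOpen_Ioo isOpen_ball isOpen_ball

lemma ocyl_vol (d : ℕ) (s : ℝ) (z₀ : Phase d) (r : ℝ) :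
    volume (ocyl d s z₀ r) = volume (kinCyl d s z₀ r) := by
  rw [kinCyl_eq_slab, ocyl, slab_vol d z₀ measurableSet_Ioo measurableSet_ball measurableSet_ball,
    slab_vol d z₀ measurableSet_Ioc measurableSet_ball measurableSet_ball, Real.volume_Ioo,
    Real.volume_Ioc]

lemma ocyl_fin (d : ℕ) (s : ℝ) (z₀ : Phase d) (r : ℝ) : volume (ocyl d s z₀ r) < ⊤ := by
  rw [ocyl, slab_vol d z₀ measurableSet_Ioo measurableSet_ball measurableSet_ball]
  exact ENNReal.mul_lt_top measure_Ioo_lt_top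
    (ENNReal.mul_lt_top measure_ball_lt_top measure_ball_lt_top)

/-- The Vitali constant. -/
def Kc (d : ℕ) : ℝ := 58 * (29 ^ d * 29 ^ d)

lemma encyl_vol (d : ℕ) (s : ℝ) (z₀ : Phase d) (r : ℝ) :
    volume (encyl d s z₀ r) = ENNReal.ofReal (Kc d) * volume (ocyl d s z₀ r) := by
  rw [encyl, ocyl, slab_vol d z₀ measurableSet_Ioo measurableSet_ball measurableSet_ball,
    slab_vol d z₀ measurableSet_Ioo measurableSet_ball measurableSet_ball, Real.volume_Ioo,
    Real.volume_Ioo, Measure.addHaar_ball_mul_of_pos _ _ (by norm_num : (0:ℝ) < 29),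
    Measure.addHaar_ball_mul_of_pos _ _ (by norm_num : (0:ℝ) < 29), finrank_euclideanSpace_fin,
    Measure.addHaar_ball_center _ z₀.2.2]
  have h1 : ENNReal.ofReal (z₀.1 + 29 * r ^ (2 * s) - (z₀.1 - 29 * r ^ (2 * s))) =
      ENNReal.ofReal 58 * ENNReal.ofReal (z₀.1 - (z₀.1 - r ^ (2 * s))) := by
    rw [← ENNReal.ofReal_mul (by norm_num)]
    congr 1
    ring
  rw [h1, Kc, ENNReal.ofReal_mul (by norm_num), ENNReal.ofReal_mul (by positivity)]
  ring

lemma encyl_sub (d : ℕ) (s : ℝ) (hs : s ∈ Set.Ioo (0 : ℝ) 1) (z₀ z₁ : Phase d) (r r' : ℝ)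
    (hr : 0 < r) (hr' : 0 < r') (hrr : r ≤ 2 * r')
    (hne : (ocyl d s z₀ r ∩ ocyl d s z₁ r').Nonempty) :
    ocyl d s z₀ r ⊆ encyl d s z₁ r' := by
  obtain ⟨q, hq0, hq1⟩ := hne
  intro p hp
  rw [mem_ocyl] at hq0 hq1 hp
  obtain ⟨⟨a1, a2⟩, a3, a4⟩ := hq0
  obtain ⟨⟨b1, b2⟩, b3, b4⟩ := hq1
  obtain ⟨⟨c1, c2⟩, c3, c4⟩ := hp
  obtain ⟨hs0, hs1⟩ := hs
  have hP : 0 < r' ^ (2 * s) := Real.rpow_pos_of_pos hr' _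
  have e1 : r ^ (2 * s) ≤ 4 * r' ^ (2 * s) := by
    calc r ^ (2 * s) ≤ (2 * r') ^ (2 * s) := Real.rpow_le_rpow hr.le hrr (by linarith)
      _ = 2 ^ (2 * s) * r' ^ (2 * s) := Real.mul_rpow (by norm_num) hr'.le
      _ ≤ 4 * r' ^ (2 * s) := by
        gcongr
        calc (2 : ℝ) ^ (2 * s) ≤ 2 ^ (2 : ℝ) :=
              Real.rpow_le_rpow_of_exponent_le (by norm_num) (by linarith)
          _ = 4 := by norm_num
  have f1 : r ^ (1 + 2 * s) = r * r ^ (2 * s) := by rw [Real.rpow_add hr, Real.rpow_one]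
  have f2 : r' ^ (1 + 2 * s) = r' * r' ^ (2 * s) := by rw [Real.rpow_add hr', Real.rpow_one]
  have hPr : 0 < r ^ (2 * s) := Real.rpow_pos_of_pos hr _
  have e2 : r ^ (1 + 2 * s) ≤ 8 * r' ^ (1 + 2 * s) := by
    rw [f1, f2]
    calc r * r ^ (2 * s) ≤ (2 * r') * (4 * r' ^ (2 * s)) := by gcongr
      _ = _ := by ring
  have hv : dist z₀.2.2 z₁.2.2 ≤ 3 * r' := by
    have := dist_triangle_left z₀.2.2 z₁.2.2 q.2.2
    linarith
  refine ⟨⟨by linarith, by linarith⟩, ?_, ?_⟩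
  · rw [Metric.mem_ball, dist_zero_right]
    have hid : p.2.1 - z₁.2.1 - (p.1 - z₁.1) • z₁.2.2 =
        (p.2.1 - z₀.2.1 - (p.1 - z₀.1) • z₀.2.2) - (q.2.1 - z₀.2.1 - (q.1 - z₀.1) • z₀.2.2)
        + (q.2.1 - z₁.2.1 - (q.1 - z₁.1) • z₁.2.2) + (p.1 - q.1) • (z₀.2.2 - z₁.2.2) := by
      module
    have hlast : ‖(p.1 - q.1) • (z₀.2.2 - z₁.2.2)‖ ≤ 12 * r' ^ (1 + 2 * s) := by
      rw [norm_smul, Real.norm_eq_abs, ← dist_eq_norm, f2]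
      have : |p.1 - q.1| ≤ 4 * r' ^ (2 * s) := by
        rw [abs_le]; constructor <;> linarith
      calc |p.1 - q.1| * dist z₀.2.2 z₁.2.2 ≤ (4 * r' ^ (2 * s)) * (3 * r') := by gcongr
        _ = _ := by ring
    rw [hid]
    have t1 := norm_add_le ((p.2.1 - z₀.2.1 - (p.1 - z₀.1) • z₀.2.2) -
        (q.2.1 - z₀.2.1 - (q.1 - z₀.1) • z₀.2.2)
        + (q.2.1 - z₁.2.1 - (q.1 - z₁.1) • z₁.2.2)) ((p.1 - q.1) • (z₀.2.2 - z₁.2.2))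
    have t2 := norm_add_le ((p.2.1 - z₀.2.1 - (p.1 - z₀.1) • z₀.2.2) -
        (q.2.1 - z₀.2.1 - (q.1 - z₀.1) • z₀.2.2)) (q.2.1 - z₁.2.1 - (q.1 - z₁.1) • z₁.2.2)
    have t3 := norm_sub_le (p.2.1 - z₀.2.1 - (p.1 - z₀.1) • z₀.2.2)
        (q.2.1 - z₀.2.1 - (q.1 - z₀.1) • z₀.2.2)
    linarith
  · rw [Metric.mem_ball]
    have := dist_triangle p.2.2 z₀.2.2 z₁.2.2
    linarith

lemma vitali (d : ℕ) (s : ℝ) (hs : s ∈ Set.Ioo (0 : ℝ) 1) (T : Set (Phase d × ℝ)) (R : ℝ)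
    (hT : ∀ p ∈ T, 0 < p.2 ∧ p.2 ≤ R) (H : Set (Phase d)) (hH : MeasurableSet H) (θ : ENNReal)
    (hθ : ∀ p ∈ T, θ * volume (ocyl d s p.1 p.2) ≤ volume (ocyl d s p.1 p.2 ∩ H)) :
    θ * volume (⋃ p ∈ T, ocyl d s p.1 p.2) ≤
      ENNReal.ofReal (Kc d) * volume ((⋃ p ∈ T, ocyl d s p.1 p.2) ∩ H) := by
  have hne : ∀ p ∈ T, (ocyl d s p.1 p.2).Nonempty := by
    intro p hp
    have h1 : 0 < p.2 ^ (2 * s) := Real.rpow_pos_of_pos (hT p hp).1 _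
    have h2 : 0 < p.2 ^ (1 + 2 * s) := Real.rpow_pos_of_pos (hT p hp).1 _
    refine ⟨(p.1.1 - p.2 ^ (2 * s) / 2,
      p.1.2.1 + (p.1.1 - p.2 ^ (2 * s) / 2 - p.1.1) • p.1.2.2, p.1.2.2), ?_⟩
    rw [mem_ocyl]
    refine ⟨⟨?_, ?_⟩, ?_, ?_⟩
    · simp only; linarith
    · simp only; linarith
    · simpa using h2
    · simpa using (hT p hp).1
  obtain ⟨u, huT, hud, hu⟩ := Vitali.exists_disjoint_subfamily_covering_enlargement
    (fun p : Phase d × ℝ => ocyl d s p.1 p.2) T (fun p => p.2) 2 (by norm_num)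
    (fun p hp => (hT p hp).1.le) R (fun p hp => (hT p hp).2) hne
  have huc : u.Countable := hud.countable_of_isOpen (fun p _ => ocyl_open d s p.1 p.2)
    (fun p hp => hne p (huT hp))
  have hcov : (⋃ p ∈ T, ocyl d s p.1 p.2) ⊆ ⋃ p ∈ u, encyl d s p.1 p.2 := by
    refine Set.iUnion₂_subset fun p hp => ?_
    obtain ⟨q, hq, hpq, hle⟩ := hu p hp
    refine Set.Subset.trans (encyl_sub d s hs p.1 q.1 p.2 q.2 (hT p hp).1 (hT q (huT hq)).1
      hle hpq) ?_
    exact Set.subset_biUnion_of_mem (u := fun p : Phase d × ℝ => encyl d s p.1 p.2) hq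
  calc θ * volume (⋃ p ∈ T, ocyl d s p.1 p.2)
      ≤ θ * ∑' p : u, volume (encyl d s p.1.1 p.1.2) :=
        mul_le_mul' le_rfl ((measure_mono hcov).trans (measure_biUnion_le _ huc _))
    _ = ∑' p : u, ENNReal.ofReal (Kc d) * (θ * volume (ocyl d s p.1.1 p.1.2)) := by
        rw [← ENNReal.tsum_mul_left]
        refine tsum_congr fun p => ?_
        rw [encyl_vol d s _ _]
        ring
    _ ≤ ∑' p : u, ENNReal.ofReal (Kc d) * volume (ocyl d s p.1.1 p.1.2 ∩ H) := by
        refine ENNReal.tsum_le_tsum fun p => ?_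
        exact mul_le_mul' le_rfl (hθ p.1 (huT p.2))
    _ = ENNReal.ofReal (Kc d) * volume (⋃ p ∈ u, (ocyl d s p.1 p.2 ∩ H)) := by
        rw [ENNReal.tsum_mul_left, measure_biUnion huc]
        · intro p hp q hq hpq
          exact (hud hp hq hpq).mono Set.inter_subset_left Set.inter_subset_left
        · intro p _
          exact (ocyl_open d s p.1 p.2).measurableSet.inter hH
    _ ≤ _ := by
        refine mul_le_mul' le_rfl (measure_mono ?_)
        refine Set.iUnion₂_subset fun p hp => ?_
        exact Set.inter_subset_inter_left _ (Set.subset_biUnion_of_mem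
          (u := fun p : Phase d × ℝ => ocyl d s p.1 p.2) (huT hp))

/-- Delayed cylinders lemma. -/
lemma stack_vol (d : ℕ) (s m : ℝ) (hm : 0 < m) (T : Set (Phase d × ℝ))
    (hT : ∀ p ∈ T, 0 < p.2) (W : Set (Phase d)) (hW : MeasurableSet W)
    (hTW : ∀ p ∈ T, kinCylStack d s m p.1 p.2 ⊆ W) :
    volume (⋃ p ∈ T, ocyl d s p.1 p.2) ≤ ENNReal.ofReal ((m + 1) / m) * volume W := by
  have hGo : IsOpen (⋃ p ∈ T, ocyl d s p.1 p.2) :=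
    isOpen_biUnion fun p _ => ocyl_open d s p.1 p.2
  rw [shear_vol d hGo.measurableSet, shear_vol d hW, ← lintegral_const_mul' _ _ ENNReal.ofReal_ne_top]
  refine lintegral_mono fun v => ?_
  rw [← lintegral_const_mul' _ _ ENNReal.ofReal_ne_top]
  refine lintegral_mono fun y => ?_
  have hc : Continuous (fun t : ℝ => ((t, y + t • v, v) : Phase d)) := by fun_prop
  refine oneD m hm {p : Phase d × ℝ | p ∈ T ∧ ∃ t : ℝ, (t, y + t • v, v) ∈ ocyl d s p.1 p.2}
    (fun p => p.1.1) (fun p => p.2 ^ (2 * s)) ?_ _ _ (hGo.preimage hc) ?_ ?_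
  · intro p hp
    exact Real.rpow_pos_of_pos (hT p hp.1) _
  · intro t ht
    obtain ⟨p, hp, htp⟩ := Set.mem_iUnion₂.1 ht
    refine Set.mem_biUnion (show p ∈ _ from ⟨hp, t, htp⟩) ?_
    rw [mem_ocyl] at htp
    exact ⟨htp.1.1, htp.1.2⟩
  · rintro p ⟨hp, τ, hτ⟩ t ⟨ht1, ht2⟩
    apply hTW p hp
    have hr := hT p hp
    rw [mem_ocyl] at hτ
    obtain ⟨⟨a1, a2⟩, a3, a4⟩ := hτ
    simp only at a1 a2 a3 a4
    refine ⟨by simp only; linarith, by simp only; linarith, a4, ?_⟩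
    simp only
    have hP : 0 < p.2 ^ (2 * s) := Real.rpow_pos_of_pos hr _
    have f1 : p.2 ^ (1 + 2 * s) = p.2 * p.2 ^ (2 * s) := by rw [Real.rpow_add hr, Real.rpow_one]
    have hid : y + t • v - p.1.2.1 - (t - p.1.1) • p.1.2.2 =
      (y + τ • v - p.1.2.1 - (τ - p.1.1) • p.1.2.2) + (t - τ) • (v - p.1.2.2) := by module
    have h2 : ‖(t - τ) • (v - p.1.2.2)‖ ≤ ((m + 1) * p.2 ^ (2 * s)) * p.2 := by
      rw [norm_smul, Real.norm_eq_abs, ← dist_eq_norm]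
      have : |t - τ| ≤ (m + 1) * p.2 ^ (2 * s) := by
        rw [abs_le]; constructor <;> nlinarith
      gcongr
    rw [hid]
    have := norm_add_le (y + τ • v - p.1.2.1 - (τ - p.1.1) • p.1.2.2) ((t - τ) • (v - p.1.2.2))
    rw [f1] at a3 ⊢
    nlinarith

lemma sign_eventually {f : ℝ → ℝ} {a : ℝ} (hf : ContinuousAt f a) (h : f a ≠ 0) :
    ∀ᶠ l in nhds a, (0 < f l ↔ 0 < f a) := by
  rcases lt_or_gt_of_ne h with h | h
  · filter_upwards [hf.eventually_lt continuousAt_const h] with l hl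
    constructor <;> intro h' <;> linarith
  · filter_upwards [continuousAt_const.eventually_lt hf h] with l hl
    exact ⟨fun _ => h, fun _ => hl⟩

lemma ocyl_cont (d : ℕ) (s : ℝ) (zf : ℝ → Phase d) (l₀ : ℝ) (h0 : 0 < l₀)
    (hz : ContinuousAt zf l₀) (E : Set (Phase d)) (hE : MeasurableSet E)
    (hEf : volume E ≠ ⊤) :
    Filter.Tendsto (fun l => volume (ocyl d s (zf l) l ∩ E)) (nhds l₀)
      (nhds (volume (ocyl d s (zf l₀) l₀ ∩ E))) := by
  have hr1 : ContinuousAt (fun l : ℝ => l ^ (2 * s)) l₀ :=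
    Real.continuousAt_rpow_const _ _ (Or.inl h0.ne')
  have hr2 : ContinuousAt (fun l : ℝ => l ^ (1 + 2 * s)) l₀ :=
    Real.continuousAt_rpow_const _ _ (Or.inl h0.ne')
  refine tendsto_measure_of_ae_tendsto_indicator (nhds l₀)
    ((ocyl_open d s _ _).measurableSet.inter hE)
    (fun l => (ocyl_open d s _ _).measurableSet.inter hE) hE hEf
    (Filter.Eventually.of_forall fun l => Set.inter_subset_right) ?_
  have n1 : volume (slab d (zf l₀) {(zf l₀).1 - l₀ ^ (2 * s)} univ univ) = 0 := by
    rw [slab_vol d _ (measurableSet_singleton _) MeasurableSet.univ MeasurableSet.univ]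
    simp
  have n2 : volume (slab d (zf l₀) {(zf l₀).1} univ univ) = 0 := by
    rw [slab_vol d _ (measurableSet_singleton _) MeasurableSet.univ MeasurableSet.univ]
    simp
  have n3 : volume (slab d (zf l₀) univ (sphere 0 (l₀ ^ (1 + 2 * s))) univ) = 0 := by
    rw [slab_vol d _ MeasurableSet.univ isClosed_sphere.measurableSet MeasurableSet.univ,
      Measure.addHaar_sphere_of_ne_zero _ _ (Real.rpow_pos_of_pos h0 _).ne']
    simp
  have n4 : volume (slab d (zf l₀) univ univ (sphere (zf l₀).2.2 l₀)) = 0 := by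
    rw [slab_vol d _ MeasurableSet.univ MeasurableSet.univ isClosed_sphere.measurableSet,
      Measure.addHaar_sphere_of_ne_zero _ _ h0.ne']
    simp
  filter_upwards [measure_eq_zero_iff_ae_notMem.1 n1, measure_eq_zero_iff_ae_notMem.1 n2,
    measure_eq_zero_iff_ae_notMem.1 n3, measure_eq_zero_iff_ae_notMem.1 n4] with p p1 p2 p3 p4
  simp only [slab, Set.mem_ofPred_eq, Set.mem_singleton_iff, Set.mem_univ, and_true, true_and,
    mem_sphere, dist_zero_right] at p1 p2 p3 p4
  have c1 : ContinuousAt (fun l => p.1 - ((zf l).1 - l ^ (2 * s))) l₀ := by fun_prop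
  have c2 : ContinuousAt (fun l => (zf l).1 - p.1) l₀ := by fun_prop
  have c3 : ContinuousAt (fun l => l ^ (1 + 2 * s) -
      ‖p.2.1 - (zf l).2.1 - (p.1 - (zf l).1) • (zf l).2.2‖) l₀ := by fun_prop
  have c4 : ContinuousAt (fun l => l - dist p.2.2 (zf l).2.2) l₀ := by fun_prop
  filter_upwards [sign_eventually c1 (by contrapose! p1; linarith),
    sign_eventually c2 (by contrapose! p2; linarith),
    sign_eventually c3 (by contrapose! p3; linarith),
    sign_eventually c4 (by contrapose! p4; linarith)] with l q1 q2 q3 q4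
  simp only [sub_pos] at q1 q2 q3 q4
  rw [Set.mem_inter_iff, Set.mem_inter_iff, mem_ocyl, mem_ocyl, q1, q2, q3, q4]

/-- Path of centers. -/
def zpath (d : ℕ) (s : ℝ) (z : Phase d) (l : ℝ) : Phase d :=
  (z.1 + l ^ (2 * s) / 2, z.2.1 + (l ^ (2 * s) / 2) • ((1 - l) • z.2.2), (1 - l) • z.2.2)

lemma zpath_cont (d : ℕ) (s : ℝ) (z : Phase d) (l : ℝ) (hl : 0 < l) :
    ContinuousAt (zpath d s z) l := by
  have hr1 : ContinuousAt (fun l : ℝ => l ^ (2 * s)) l :=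
    Real.continuousAt_rpow_const _ _ (Or.inl hl.ne')
  unfold zpath
  fun_prop

lemma zpath_mem (d : ℕ) (s : ℝ) (z : Phase d) (l : ℝ) (hl : 0 < l) (hv : ‖z.2.2‖ < 1) :
    z ∈ ocyl d s (zpath d s z l) l := by
  have h1 : 0 < l ^ (2 * s) := Real.rpow_pos_of_pos hl _
  have h2 : 0 < l ^ (1 + 2 * s) := Real.rpow_pos_of_pos hl _
  rw [mem_ocyl]
  refine ⟨⟨?_, ?_⟩, ?_, ?_⟩
  · simp only [zpath]; linarith
  · simp only [zpath]; linarith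
  · have : z.2.1 - (zpath d s z l).2.1 - (z.1 - (zpath d s z l).1) • (zpath d s z l).2.2 = 0 := by
      simp only [zpath]; module
    rw [this, norm_zero]; exact h2
  · have : z.2.2 - (zpath d s z l).2.2 = l • z.2.2 := by
      simp only [zpath]; module
    rw [dist_eq_norm, this, norm_smul, Real.norm_eq_abs, abs_of_pos hl]
    nlinarith

/-- Bounds for points in the cylinders along the path. -/
lemma zpath_bound (d : ℕ) (s : ℝ) (z : Phase d) (l : ℝ) (hl : 0 < l) (hl1 : l ≤ 1)
    (hv : ‖z.2.2‖ < 1) (p : Phase d) (hp : p ∈ kinCyl d s (zpath d s z l) l) :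
    |p.1 - z.1| ≤ l ^ (2 * s) / 2 ∧ ‖p.2.1 - z.2.1‖ < 2 * l ^ (2 * s) ∧
      ‖p.2.2‖ < 1 ∧ ‖p.2.2 - z.2.2‖ < 2 * l := by
  have h1 : 0 < l ^ (2 * s) := Real.rpow_pos_of_pos hl _
  have f1 : l ^ (1 + 2 * s) = l * l ^ (2 * s) := by rw [Real.rpow_add hl, Real.rpow_one]
  obtain ⟨a1, a2, a3, a4⟩ := hp
  have hvl : ‖(1 - l) • z.2.2‖ ≤ 1 - l := by
    rw [norm_smul, Real.norm_eq_abs, abs_of_nonneg (by linarith)]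
    nlinarith
  have hvl2 : ‖(1 - l) • z.2.2‖ ≤ 1 := by linarith
  simp only [zpath] at a1 a2 a3 a4
  have hab : |p.1 - z.1| ≤ l ^ (2 * s) / 2 := by rw [abs_le]; constructor <;> linarith
  refine ⟨hab, ?_, ?_, ?_⟩
  · have hid : p.2.1 - z.2.1 = (p.2.1 - (z.2.1 + (l ^ (2 * s) / 2) • ((1 - l) • z.2.2)) -
        (p.1 - (z.1 + l ^ (2 * s) / 2)) • ((1 - l) • z.2.2)) +
        (p.1 - z.1) • ((1 - l) • z.2.2) := by module
    have h3 : ‖(p.1 - z.1) • ((1 - l) • z.2.2)‖ ≤ l ^ (2 * s) / 2 * 1 := by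
      rw [norm_smul, Real.norm_eq_abs]; gcongr
    rw [hid]
    refine (norm_add_le _ _).trans_lt ?_
    nlinarith
  · rw [dist_eq_norm] at a3
    have : p.2.2 = (p.2.2 - (1 - l) • z.2.2) + (1 - l) • z.2.2 := by abel
    rw [this]
    refine (norm_add_le _ _).trans_lt ?_
    linarith
  · rw [dist_eq_norm] at a3
    have : p.2.2 - z.2.2 = (p.2.2 - (1 - l) • z.2.2) + (-l) • z.2.2 := by module
    rw [this]
    refine (norm_add_le _ _).trans_lt ?_
    rw [norm_smul, Real.norm_eq_abs, abs_neg, abs_of_pos hl]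
    nlinarith

lemma zpath_small (d : ℕ) (s : ℝ) (hs : s ∈ Set.Ioo (0 : ℝ) 1) (z : Phase d)
    (hv : ‖z.2.2‖ < 1) (O : Set (Phase d)) (hO : IsOpen O) (hzO : z ∈ O) (r₀ : ℝ) (hr₀ : 0 < r₀) :
    ∃ l, 0 < l ∧ l ≤ r₀ ∧ ocyl d s (zpath d s z l) l ⊆ O := by
  obtain ⟨ε, hε, hball⟩ := Metric.isOpen_iff.1 hO z hzO
  have hc : ContinuousAt (fun l : ℝ => 2 * l ^ (2 * s)) 0 :=
    continuousAt_const.mul (Real.continuousAt_rpow_const _ _ (Or.inr (by linarith [hs.1])))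
  have h0 : (fun l : ℝ => 2 * l ^ (2 * s)) 0 < ε := by
    simp only [Real.zero_rpow (by linarith [hs.1] : 2 * s ≠ 0 )]
    linarith
  have hev : ∀ᶠ l in nhdsWithin (0 : ℝ) (Ioi 0), 2 * l ^ (2 * s) < ε ∧ l < min (min 1 r₀) (ε / 2) ∧
      0 < l := by
    have e1 := (hc.eventually_lt continuousAt_const h0).filter_mono
      (nhdsWithin_le_nhds (s := Ioi (0:ℝ)))
    have e2 : ∀ᶠ l in nhdsWithin (0 : ℝ) (Ioi 0), l < min (min 1 r₀) (ε / 2) :=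
      nhdsWithin_le_nhds (eventually_lt_nhds (by positivity))
    filter_upwards [e1, e2, self_mem_nhdsWithin] with l h1 h2 h3
    exact ⟨h1, h2, h3⟩
  obtain ⟨l, h1, h2, h3⟩ := hev.exists
  simp only [lt_min_iff] at h2
  obtain ⟨⟨h4, h5⟩, h6⟩ := h2
  refine ⟨l, h3, h5.le, fun p hp => hball ?_⟩
  obtain ⟨b1, b2, b3, b4⟩ := zpath_bound d s z l h3 h4.le hv p (ocyl_sub d s _ _ hp)
  have hP : 0 < l ^ (2 * s) := Real.rpow_pos_of_pos h3 _
  rw [Metric.mem_ball, Prod.dist_eq, Prod.dist_eq, max_lt_iff, max_lt_iff, dist_eq_norm,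
    dist_eq_norm, dist_eq_norm, Real.norm_eq_abs]
  refine ⟨by linarith, by linarith, by linarith⟩

/-- Density lemma: almost every point of `E` sees some dense small cylinder of its path. -/
lemma density (d : ℕ) (s : ℝ) (hs : s ∈ Set.Ioo (0 : ℝ) 1) (E : Set (Phase d))
    (hE : MeasurableSet E) (hEf : volume E ≠ ⊤) (μ r₀ : ℝ) (hμ : μ ∈ Set.Ioo (0 : ℝ) 1)
    (hr₀ : 0 < r₀) :
    volume {z : Phase d | z ∈ E ∧ ‖z.2.2‖ < 1 ∧ ∀ l, 0 < l → l ≤ r₀ →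
      ENNReal.ofReal μ * volume (ocyl d s (zpath d s z l) l) ≤
        volume (ocyl d s (zpath d s z l) l \ E)} = 0 := by
  set N := {z : Phase d | z ∈ E ∧ ‖z.2.2‖ < 1 ∧ ∀ l, 0 < l → l ≤ r₀ →
      ENNReal.ofReal μ * volume (ocyl d s (zpath d s z l) l) ≤
        volume (ocyl d s (zpath d s z l) l \ E)} with hN
  have hμ0 : ENNReal.ofReal μ ≠ 0 := by simpa using hμ.1
  have key : ∀ ε : NNReal, 0 < ε →
      ENNReal.ofReal μ * volume N ≤ ENNReal.ofReal (Kc d) * ε := by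
    intro ε hε
    obtain ⟨O, hEO, hOo, hOlt⟩ := E.exists_isOpen_lt_add hEf
      (ENNReal.coe_ne_zero.2 hε.ne')
    have hOE : volume (O \ E) ≤ ε := by
      rw [measure_sdiff hEO hE.nullMeasurableSet hEf]
      exact tsub_le_iff_left.2 hOlt.le
    let T : Set (Phase d × ℝ) := {p | 0 < p.2 ∧ p.2 ≤ r₀ ∧
      ENNReal.ofReal μ * volume (ocyl d s p.1 p.2) ≤ volume (ocyl d s p.1 p.2 ∩ (O \ E))}
    have hv := vitali d s hs T r₀ (fun p hp => ⟨hp.1, hp.2.1⟩) (O \ E)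
      (hOo.measurableSet.diff hE) (ENNReal.ofReal μ) (fun p hp => hp.2.2)
    have hsub : N ⊆ ⋃ p ∈ T, ocyl d s p.1 p.2 := by
      rintro z ⟨hzE, hzv, hz⟩
      obtain ⟨l, hl0, hlr, hlO⟩ := zpath_small d s hs z hzv O hOo (hEO hzE) r₀ hr₀
      refine Set.mem_biUnion (show (zpath d s z l, l) ∈ T from ⟨hl0, hlr, ?_⟩)
        (zpath_mem d s z l hl0 hzv)
      refine (hz l hl0 hlr).trans (measure_mono ?_)
      exact fun p hp => ⟨hp.1, hlO hp.1, hp.2⟩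
    calc ENNReal.ofReal μ * volume N ≤ _ := mul_le_mul' le_rfl (measure_mono hsub)
      _ ≤ _ := hv
      _ ≤ _ := mul_le_mul' le_rfl ((measure_mono Set.inter_subset_right).trans hOE)
  by_contra hne
  have hpos : ENNReal.ofReal μ * volume N ≠ 0 := mul_ne_zero hμ0 hne
  have hlim : Filter.Tendsto (fun ε : NNReal => ENNReal.ofReal (Kc d) * (ε : ENNReal))
      (nhdsWithin 0 (Ioi 0)) (nhds 0) := by
    have : Filter.Tendsto (fun ε : NNReal => ENNReal.ofReal (Kc d) * (ε : ENNReal))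
      (nhds 0) (nhds (ENNReal.ofReal (Kc d) * ((0 : NNReal) : ENNReal))) :=
      ENNReal.Tendsto.const_mul (ENNReal.continuous_coe.tendsto 0) (Or.inr ENNReal.ofReal_ne_top)
    rw [ENNReal.coe_zero, mul_zero] at this
    exact this.mono_left nhdsWithin_le_nhds
  have := ge_of_tendsto hlim (by
    filter_upwards [self_mem_nhdsWithin] with ε hε using key ε hε)
  exact hpos (le_antisymm this (zero_le))

/-- Volume of the unit ball. -/
def Vb (d : ℕ) : ℝ := (volume (ball (0 : VSp d) 1)).toReal

lemma ball_vol (d : ℕ) (r : ℝ) (hr : 0 < r) :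
    volume (ball (0 : VSp d) r) = ENNReal.ofReal (r ^ d * Vb d) := by
  rw [Measure.addHaar_ball_of_pos _ _ hr, finrank_euclideanSpace_fin,
    ENNReal.ofReal_mul (by positivity), Vb, ENNReal.ofReal_toReal measure_ball_lt_top.ne]

lemma Vb_nonneg (d : ℕ) : 0 ≤ Vb d := ENNReal.toReal_nonneg

lemma annulus_vol (d : ℕ) (a b : ℝ) (ha : 0 < a) (hab : a ≤ b) :
    volume (ball (0 : VSp d) b \ ball 0 a) = ENNReal.ofReal ((b ^ d - a ^ d) * Vb d) := by
  rw [measure_sdiff (ball_subset_ball hab) measurableSet_ball.nullMeasurableSet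
    measure_ball_lt_top.ne, ball_vol d a ha, ball_vol d b (by linarith),
    ← ENNReal.ofReal_sub _ (by have := Vb_nonneg d; positivity), sub_mul]

lemma unit_vol (d : ℕ) (s : ℝ) : volume (unitCyl d s) = ENNReal.ofReal (Vb d ^ 2) := by
  rw [unitCyl, kinCyl_eq_slab, slab_vol d _ measurableSet_Ioc measurableSet_ball measurableSet_ball]
  have := Vb_nonneg d
  simp only [Real.one_rpow, Prod.fst_zero, Prod.snd_zero, Real.volume_Ioc,
    ball_vol d 1 one_pos, one_pow, one_mul, ← ENNReal.ofReal_mul this]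
  norm_num
  rw [sq]

lemma unit_meas (d : ℕ) (s : ℝ) : MeasurableSet (unitCyl d s) := by
  rw [unitCyl, kinCyl_eq_slab]
  exact slab_meas d _ measurableSet_Ioc measurableSet_ball measurableSet_ball

lemma mem_unit (d : ℕ) (s : ℝ) (z : Phase d) :
    z ∈ unitCyl d s ↔ -1 < z.1 ∧ z.1 ≤ 0 ∧ ‖z.2.2‖ < 1 ∧ ‖z.2.1‖ < 1 := by
  simp [unitCyl, kinCyl]

lemma pow_bound (d : ℕ) (h : ℝ) (h0 : 0 ≤ h) (h1 : h ≤ 1) : (1 + h) ^ d - 1 ≤ (2 ^ d - 1) * h := by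
  induction d with
  | zero => simp
  | succ n ih =>
    have h2 : (1 : ℝ) ≤ 2 ^ n := one_le_pow₀ (by norm_num)
    rw [pow_succ, pow_succ]
    nlinarith [mul_nonneg (sub_nonneg.2 h2) (mul_nonneg h0 (sub_nonneg.2 h1))]

/-- Region of leakage outside the unit cylinder. -/
def leak (d : ℕ) (η : ℝ) : Set (Phase d) :=
  slab d 0 (Ioc 0 η) (ball 0 2) (ball 0 1) ∪
    slab d 0 (Ioc (-1) 0) (ball 0 (1 + 4 * η) \ ball 0 1) (ball 0 1)

lemma leak_meas (d : ℕ) (η : ℝ) : MeasurableSet (leak d η) :=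
  (slab_meas d _ measurableSet_Ioc measurableSet_ball measurableSet_ball).union
    (slab_meas d _ measurableSet_Ioc (measurableSet_ball.diff measurableSet_ball)
      measurableSet_ball)

lemma leak_vol (d : ℕ) (η : ℝ) (h0 : 0 < η) (h1 : η ≤ 1 / 4) :
    volume (leak d η) ≤ ENNReal.ofReal (5 * 2 ^ d * Vb d ^ 2 * η) := by
  have hV := Vb_nonneg d
  have hpb := pow_bound d (4 * η) (by linarith) (by linarith)
  have h4 : (1 : ℝ) ≤ (1 + 4 * η) ^ d := one_le_pow₀ (by linarith)
  refine (measure_union_le _ _).trans ?_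
  rw [slab_vol d _ measurableSet_Ioc measurableSet_ball measurableSet_ball,
    slab_vol d _ measurableSet_Ioc (measurableSet_ball.diff measurableSet_ball)
      measurableSet_ball, annulus_vol d 1 (1 + 4 * η) one_pos (by linarith),
      ball_vol d 1 one_pos, ball_vol d 2 two_pos, Real.volume_Ioc, Real.volume_Ioc,
      one_pow, one_mul, ← ENNReal.ofReal_mul (by positivity), ← ENNReal.ofReal_mul (by linarith),
      ← ENNReal.ofReal_mul (mul_nonneg (by linarith) hV), ← ENNReal.ofReal_mul (by norm_num),
      ← ENNReal.ofReal_add (mul_nonneg (by linarith) (by positivity))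
        (mul_nonneg (by norm_num) (mul_nonneg (mul_nonneg (by linarith) hV) hV))]
  apply ENNReal.ofReal_le_ofReal
  have : ((1 + 4 * η) ^ d - 1) * Vb d ^ 2 ≤ (2 ^ d - 1) * (4 * η) * Vb d ^ 2 := by gcongr
  nlinarith [mul_nonneg h0.le (sq_nonneg (Vb d))]

/-- Boundary layer inside the unit cylinder. -/
def bdry (d : ℕ) (ρ : ℝ) : Set (Phase d) :=
  slab d 0 (Ioc (-1) (-1 + ρ)) (ball 0 1) (ball 0 1) ∪
    (slab d 0 (Icc (-ρ) 0) (ball 0 1) (ball 0 1) ∪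
    slab d 0 (Ioc (-1) 0) (ball 0 1 \ ball 0 (1 - 2 * ρ)) (ball 0 1))

lemma bdry_vol (d : ℕ) (ρ : ℝ) (h0 : 0 < ρ) (h1 : ρ ≤ 1 / 4) :
    volume (bdry d ρ) ≤ ENNReal.ofReal ((2 + 2 * d) * Vb d ^ 2 * ρ) := by
  have hV := Vb_nonneg d
  have hpb := one_add_mul_le_pow (a := -(2 * ρ)) (by linarith) d
  have h4 : (1 - 2 * ρ) ^ d ≤ 1 := pow_le_one₀ (by linarith) (by linarith)
  refine (measure_union_le _ _).trans ((add_le_add le_rfl (measure_union_le _ _)).trans ?_)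
  rw [slab_vol d _ measurableSet_Ioc measurableSet_ball measurableSet_ball,
    slab_vol d _ measurableSet_Icc measurableSet_ball measurableSet_ball,
    slab_vol d _ measurableSet_Ioc (measurableSet_ball.diff measurableSet_ball)
      measurableSet_ball, annulus_vol d (1 - 2 * ρ) 1 (by linarith) (by linarith),
      ball_vol d 1 one_pos, Real.volume_Ioc, Real.volume_Ioc, Real.volume_Icc,
      one_pow, one_mul, ← ENNReal.ofReal_mul hV, ← ENNReal.ofReal_mul (by linarith),
      ← ENNReal.ofReal_mul (by linarith),
      ← ENNReal.ofReal_mul (mul_nonneg (by linarith) hV), ← ENNReal.ofReal_mul (by norm_num),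
      ← ENNReal.ofReal_add (mul_nonneg (by linarith) (by positivity))
        (mul_nonneg (by norm_num) (mul_nonneg (mul_nonneg (by linarith) hV) hV)),
      ← ENNReal.ofReal_add (mul_nonneg (by linarith) (by positivity))
        (add_nonneg (mul_nonneg (by linarith) (by positivity))
        (mul_nonneg (by norm_num) (mul_nonneg (mul_nonneg (by linarith) hV) hV)))]
  apply ENNReal.ofReal_le_ofReal
  have h5 : 1 - (1 - 2 * ρ) ^ d ≤ d * (2 * ρ) := by
    have : (1 + -(2 * ρ)) = 1 - 2 * ρ := by ring
    rw [this] at hpb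
    linarith
  have : (1 - (1 - 2 * ρ) ^ d) * Vb d ^ 2 ≤ (d * (2 * ρ)) * Vb d ^ 2 := by gcongr
  nlinarith

lemma stack_sub (d : ℕ) (s m r₀ : ℝ) (hs : s ∈ Set.Ioo (0 : ℝ) 1) (hm : 1 ≤ m)
    (hη : m * r₀ ^ (2 * s) ≤ 1 / 4) (hr₀1 : r₀ ≤ 1) (z₀ : Phase d) (r : ℝ) (hr : 0 < r)
    (hrr : r < r₀) (hsub : kinCyl d s z₀ r ⊆ unitCyl d s) :
    kinCylStack d s m z₀ r ⊆ unitCyl d s ∪ leak d (m * r₀ ^ (2 * s)) := by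
  have hP : 0 < r ^ (2 * s) := Real.rpow_pos_of_pos hr _
  have f1 : r ^ (1 + 2 * s) = r * r ^ (2 * s) := by rw [Real.rpow_add hr, Real.rpow_one]
  have hle : r ^ (2 * s) ≤ r₀ ^ (2 * s) := Real.rpow_le_rpow hr.le hrr.le (by linarith [hs.1])
  have hP1 : 0 < r ^ (1 + 2 * s) := Real.rpow_pos_of_pos hr _
  have hle1 : r ^ (1 + 2 * s) ≤ r₀ ^ (2 * s) := by rw [f1]; nlinarith
  rintro ⟨t, x, v⟩ ⟨h1, h2, h3, h4⟩
  simp only at h1 h2 h3 h4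
  have hz : (z₀.1, z₀.2.1, v) ∈ kinCyl d s z₀ r := by
    refine ⟨?_, le_rfl, h3, ?_⟩
    · simp only; linarith
    · simpa using hP1
  have hz0 : z₀ ∈ kinCyl d s z₀ r := by
    refine ⟨?_, le_rfl, ?_, ?_⟩
    · linarith
    · simpa using hr
    · simpa using hP1
  have hz' := (mem_unit d s _).1 (hsub hz)
  have hz0' := (mem_unit d s _).1 (hsub hz0)
  obtain ⟨a1, a2, a3, a4⟩ := hz'
  obtain ⟨-, -, b3, -⟩ := hz0'
  simp only at a1 a2 a3 a4
  set η := m * r₀ ^ (2 * s) with hηdef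
  have hmr : m * r ^ (2 * s) ≤ η := by rw [hηdef]; gcongr
  have hx : ‖x‖ < 1 + 4 * η := by
    have hid : x = (x - z₀.2.1 - (t - z₀.1) • z₀.2.2) + z₀.2.1 + (t - z₀.1) • z₀.2.2 := by abel
    have h5 : ‖(t - z₀.1) • z₀.2.2‖ ≤ η * 1 := by
      rw [norm_smul, Real.norm_eq_abs, abs_of_pos h1]
      gcongr <;> linarith
    have h6 : (m + 2) * r ^ (1 + 2 * s) ≤ 3 * η := by
      calc (m + 2) * r ^ (1 + 2 * s) ≤ (3 * m) * r₀ ^ (2 * s) := by gcongr; linarith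
        _ = 3 * η := by rw [hηdef]; ring
    rw [hid]
    have t1 := norm_add_le ((x - z₀.2.1 - (t - z₀.1) • z₀.2.2) + z₀.2.1) ((t - z₀.1) • z₀.2.2)
    have t2 := norm_add_le (x - z₀.2.1 - (t - z₀.1) • z₀.2.2) z₀.2.1
    linarith
  by_cases ht : t ≤ 0
  · by_cases hx1 : ‖x‖ < 1
    · left
      rw [mem_unit]
      exact ⟨by simp only; linarith, ht, a3, hx1⟩
    · right; right
      refine ⟨⟨by simp only; linarith, ht⟩, ⟨?_, ?_⟩, ?_⟩
      · simpa using hx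
      · simpa using hx1
      · simpa using a3
  · right; left
    refine ⟨⟨by simp only; linarith, by simp only; linarith⟩, ?_, ?_⟩
    · simp only [Prod.fst_zero, Prod.snd_zero, smul_zero, sub_zero, mem_ball, dist_zero_right]
      linarith
    · simpa using a3

/-- Stopping argument. -/
lemma stopping (d : ℕ) (s : ℝ) (hs : s ∈ Set.Ioo (0 : ℝ) 1) (E : Set (Phase d))
    (hE : MeasurableSet E) (μ r₀ : ℝ) (hμ : μ ∈ Set.Ioo (0 : ℝ) 1)
    (hr₀ : 0 < r₀) (hr₀1 : r₀ ≤ 1) (z : Phase d) (ht1 : -1 + r₀ ^ (2 * s) < z.1)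
    (ht2 : z.1 < - r₀ ^ (2 * s)) (hx : ‖z.2.1‖ < 1 - 2 * r₀ ^ (2 * s)) (hv : ‖z.2.2‖ < 1)
    (hbad : kinCyl d s (zpath d s z r₀) r₀ ⊆ unitCyl d s →
      ¬ (ENNReal.ofReal (1 - μ) * volume (kinCyl d s (zpath d s z r₀) r₀) ≤
            volume (kinCyl d s (zpath d s z r₀) r₀ ∩ E)))
    (hgood : ¬ ∀ l, 0 < l → l ≤ r₀ →
      ENNReal.ofReal μ * volume (ocyl d s (zpath d s z l) l) ≤
        volume (ocyl d s (zpath d s z l) l \ E)) :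
    ∃ l, 0 < l ∧ kinCyl d s (zpath d s z l) l ⊆ unitCyl d s ∧
      ENNReal.ofReal μ * volume (ocyl d s (zpath d s z l) l) =
        volume (ocyl d s (zpath d s z l) l \ E) := by
  have hsub : ∀ l, 0 < l → l ≤ r₀ → kinCyl d s (zpath d s z l) l ⊆ unitCyl d s := by
    intro l hl hlr p hp
    obtain ⟨b1, b2, b3, b4⟩ := zpath_bound d s z l hl (hlr.trans hr₀1) hv p hp
    have hle : l ^ (2 * s) ≤ r₀ ^ (2 * s) := Real.rpow_le_rpow hl.le hlr (by linarith [hs.1])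
    have hP : 0 < l ^ (2 * s) := Real.rpow_pos_of_pos hl _
    rw [abs_le] at b1
    rw [mem_unit]
    refine ⟨by linarith, by linarith, b3, ?_⟩
    have : p.2.1 = (p.2.1 - z.2.1) + z.2.1 := by abel
    rw [this]
    refine (norm_add_le _ _).trans_lt ?_
    linarith
  have hQf : volume (unitCyl d s) ≠ ⊤ := by rw [unit_vol]; exact ENNReal.ofReal_ne_top
  have hQEf : volume (unitCyl d s \ E) ≠ ⊤ :=
    ((measure_mono Set.sdiff_subset).trans_lt (lt_top_iff_ne_top.2 hQf)).ne
  push Not at hgood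
  obtain ⟨l₁, hl₁, hl₁r, hgl⟩ := hgood
  let f : ℝ → ℝ := fun l => (volume (ocyl d s (zpath d s z l) l ∩ (unitCyl d s \ E))).toReal -
    μ * (volume (ocyl d s (zpath d s z l) l ∩ unitCyl d s)).toReal
  have hf : ContinuousOn f (Icc l₁ r₀) := by
    intro l hl
    have hl0 : 0 < l := lt_of_lt_of_le hl₁ hl.1
    have fin1 : ∀ A : Set (Phase d), volume (ocyl d s (zpath d s z l) l ∩ A) ≠ ⊤ := fun A =>
      ((measure_mono Set.inter_subset_left).trans_lt (ocyl_fin d s _ _)).ne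
    have c1 := (ENNReal.tendsto_toReal (fin1 _)).comp
      (ocyl_cont d s (zpath d s z) l hl0 (zpath_cont d s z l hl0) _
      ((unit_meas d s).diff hE) hQEf)
    have c2 := (ENNReal.tendsto_toReal (fin1 _)).comp
      (ocyl_cont d s (zpath d s z) l hl0 (zpath_cont d s z l hl0) _ (unit_meas d s) hQf)
    have : ContinuousAt f l := c1.sub (c2.const_mul μ)
    exact this.continuousWithinAt
  have hf' : ∀ l, 0 < l → l ≤ r₀ → f l = (volume (ocyl d s (zpath d s z l) l \ E)).toReal -
      μ * (volume (ocyl d s (zpath d s z l) l)).toReal := by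
    intro l hl hlr
    have h1 := (ocyl_sub d s (zpath d s z l) l).trans (hsub l hl hlr)
    have e1 : ocyl d s (zpath d s z l) l ∩ unitCyl d s = ocyl d s (zpath d s z l) l :=
      Set.inter_eq_left.2 h1
    have e2 : ocyl d s (zpath d s z l) l ∩ (unitCyl d s \ E) = ocyl d s (zpath d s z l) l \ E := by
      ext p
      exact ⟨fun h => ⟨h.1, h.2.2⟩, fun h => ⟨h.1, h1 h.1, h.2⟩⟩
    simp only [f, e1, e2]
  have hofR : ∀ l, ENNReal.ofReal μ * volume (ocyl d s (zpath d s z l) l) =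
      ENNReal.ofReal (μ * (volume (ocyl d s (zpath d s z l) l)).toReal) := by
    intro l
    rw [ENNReal.ofReal_mul hμ.1.le, ENNReal.ofReal_toReal (ocyl_fin d s _ _).ne]
  have hdf : ∀ l, volume (ocyl d s (zpath d s z l) l \ E) ≠ ⊤ := fun l =>
    ((measure_mono Set.sdiff_subset).trans_lt (ocyl_fin d s _ _)).ne
  have hfl : f l₁ ≤ 0 := by
    rw [hf' l₁ hl₁ hl₁r]
    rw [hofR, ← ENNReal.ofReal_toReal (hdf l₁)] at hgl
    have := (ENNReal.ofReal_lt_ofReal_iff_of_nonneg ENNReal.toReal_nonneg).1 hgl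
    linarith
  have hfr : 0 ≤ f r₀ := by
    rw [hf' r₀ hr₀ le_rfl]
    have hb := hbad (hsub r₀ hr₀ le_rfl)
    rw [not_le, ← ocyl_vol] at hb
    have hb2 : volume (ocyl d s (zpath d s z r₀) r₀ ∩ E) <
        ENNReal.ofReal (1 - μ) * volume (ocyl d s (zpath d s z r₀) r₀) :=
      (measure_mono (Set.inter_subset_inter_left _ (ocyl_sub d s _ _))).trans_lt hb
    have fin1 : volume (ocyl d s (zpath d s z r₀) r₀ ∩ E) ≠ ⊤ :=
      ((measure_mono Set.inter_subset_left).trans_lt (ocyl_fin d s _ _)).ne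
    have hsum := measure_inter_add_sdiff (μ := volume) (ocyl d s (zpath d s z r₀) r₀) hE
    have hsumR := congrArg ENNReal.toReal hsum
    rw [ENNReal.toReal_add fin1 (hdf r₀)] at hsumR
    have h3 := (ENNReal.toReal_lt_toReal fin1 (ENNReal.mul_lt_top ENNReal.ofReal_lt_top
      (ocyl_fin d s _ _)).ne).2 hb2
    rw [ENNReal.toReal_mul, ENNReal.toReal_ofReal (by linarith [hμ.2])] at h3
    linarith
  obtain ⟨l, hl, hl0⟩ := intermediate_value_Icc hl₁r hf ⟨hfl, hfr⟩
  have hlp : 0 < l := lt_of_lt_of_le hl₁ hl.1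
  refine ⟨l, hlp, hsub l hlp hl.2, ?_⟩
  rw [hf' l hlp hl.2] at hl0
  rw [hofR, ← ENNReal.ofReal_toReal (hdf l)]
  congr 1
  linarith


/-- **Ink-spots theorem with leakage.** There are constants `c ∈ (0,1)` and `C > 0`,
depending only on `d` and `s`, such that: for `μ ∈ (0,1)`, `m ≥ 1`, `r₀ > 0`, and bounded
measurable sets `E ⊆ F` with `E ⊆ Q₁`, if every slanted kinetic cylinder
`Q = Q_r(z₀) ⊆ Q₁` with `|Q ∩ E| ≥ (1-μ)|Q|` satisfies both `Q̄^m(z₀,r) ⊆ F` and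
`r < r₀`, then `|E| ≤ ((m+1)/m)(1 - cμ)(|F ∩ Q₁| + C m r₀^{2s})`. -/
theorem kinCyl_inkspots_leakage (d : ℕ) (hd : 1 ≤ d) (s : ℝ)
    (hs : s ∈ Set.Ioo (0 : ℝ) 1) :
    ∃ c C : ℝ, c ∈ Set.Ioo (0 : ℝ) 1 ∧ 0 < C ∧
      ∀ (μ m r₀ : ℝ), μ ∈ Set.Ioo (0 : ℝ) 1 → 1 ≤ m → 0 < r₀ →
      ∀ (E F : Set (Phase d)), MeasurableSet E → MeasurableSet F →
        Bornology.IsBounded E → Bornology.IsBounded F → E ⊆ F →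
        E ⊆ unitCyl d s →
        (∀ (z₀ : Phase d) (r : ℝ), 0 < r → kinCyl d s z₀ r ⊆ unitCyl d s →
          ENNReal.ofReal (1 - μ) * volume (kinCyl d s z₀ r) ≤
            volume (kinCyl d s z₀ r ∩ E) →
          kinCylStack d s m z₀ r ⊆ F ∧ r < r₀) →
        volume E ≤ ENNReal.ofReal ((m + 1) / m * (1 - c * μ)) *
          (volume (F ∩ unitCyl d s) + ENNReal.ofReal (C * m * r₀ ^ (2 * s))) := by
  have hV := Vb_nonneg d
  have hK : 58 ≤ Kc d := by
    have : (1 : ℝ) ≤ 29 ^ d := one_le_pow₀ (by norm_num)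
    unfold Kc
    nlinarith
  set C₁ : ℝ := 5 * 2 ^ d * Vb d ^ 2 with hC₁
  set C₂ : ℝ := (2 + 2 * d) * Vb d ^ 2 with hC₂
  have hC₁0 : 0 ≤ C₁ := by positivity
  have hC₂0 : 0 ≤ C₂ := by positivity
  refine ⟨1 / Kc d, C₁ + 2 * C₂ + 8 * Vb d ^ 2 + 1, ⟨by positivity, ?_⟩, by positivity, ?_⟩
  · rw [div_lt_one (by linarith)]; linarith
  intro μ m r₀ hμ hm hr₀ E F hE hF _ _ _ hEQ hyp
  set ρ := r₀ ^ (2 * s) with hρdef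
  have hρ : 0 < ρ := Real.rpow_pos_of_pos hr₀ _
  set A := (m + 1) / m with hA
  set B := 1 - 1 / Kc d * μ with hB
  have hA1 : 1 ≤ A := by rw [hA, le_div_iff₀ (by linarith)]; linarith
  have hcle : 1 / Kc d ≤ 1 / 2 := one_div_le_one_div_of_le (by norm_num) (by linarith)
  have hc0 : 0 < 1 / Kc d := by positivity
  have hB2 : 1 / 2 ≤ B := by
    rw [hB]; nlinarith [hμ.1, hμ.2]
  have hAB : 1 / 2 ≤ A * B := by nlinarith
  have hQv := unit_vol d s
  by_cases hη : m * ρ ≤ 1 / 4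
  swap
  · -- trivial case
    push Not at hη
    calc volume E ≤ volume (unitCyl d s) := measure_mono hEQ
      _ = ENNReal.ofReal (Vb d ^ 2) := hQv
      _ ≤ ENNReal.ofReal (A * B) *
          ENNReal.ofReal ((C₁ + 2 * C₂ + 8 * Vb d ^ 2 + 1) * m * ρ) := by
        rw [← ENNReal.ofReal_mul (by linarith)]
        apply ENNReal.ofReal_le_ofReal
        have h1 : 2 * Vb d ^ 2 ≤ (C₁ + 2 * C₂ + 8 * Vb d ^ 2 + 1) * m * ρ := by
          rw [mul_assoc]
          calc 2 * Vb d ^ 2 = (8 * Vb d ^ 2) * (1 / 4) := by ring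
            _ ≤ (C₁ + 2 * C₂ + 8 * Vb d ^ 2 + 1) * (m * ρ) := by
              apply mul_le_mul _ hη.le (by norm_num) (by positivity)
              linarith
        calc Vb d ^ 2 = 1 / 2 * (2 * Vb d ^ 2) := by ring
          _ ≤ _ := mul_le_mul hAB h1 (by positivity) (by linarith)
      _ ≤ _ := mul_le_mul' le_rfl le_add_self
  -- main case
  have hρ4 : ρ ≤ 1 / 4 := by nlinarith
  have hr₀1 : r₀ ≤ 1 := by
    by_contra h
    push Not at h
    have : 1 < ρ := Real.one_lt_rpow h (by linarith [hs.1])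
    linarith
  have hEf : volume E ≠ ⊤ :=
    ((measure_mono hEQ).trans_lt (by rw [hQv]; exact ENNReal.ofReal_lt_top)).ne
  let T : Set (Phase d × ℝ) := {p | 0 < p.2 ∧ kinCyl d s p.1 p.2 ⊆ unitCyl d s ∧
    ENNReal.ofReal μ * volume (ocyl d s p.1 p.2) = volume (ocyl d s p.1 p.2 \ E)}
  have hT : ∀ p ∈ T, kinCylStack d s m p.1 p.2 ⊆ F ∧ p.2 < r₀ := by
    rintro p ⟨hp0, hpQ, hpE⟩
    refine hyp p.1 p.2 hp0 hpQ ?_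
    rw [← ocyl_vol]
    refine le_trans ?_ (measure_mono (Set.inter_subset_inter_left _ (ocyl_sub d s p.1 p.2)))
    have hsum := measure_inter_add_sdiff (μ := volume) (ocyl d s p.1 p.2) hE
    rw [← hpE] at hsum
    have hfin := (ocyl_fin d s p.1 p.2).ne
    have hsplit : volume (ocyl d s p.1 p.2) = ENNReal.ofReal (1 - μ) * volume (ocyl d s p.1 p.2)
        + ENNReal.ofReal μ * volume (ocyl d s p.1 p.2) := by
      rw [← add_mul, ← ENNReal.ofReal_add (by linarith [hμ.2]) hμ.1.le]
      simp
    have hfin2 : ENNReal.ofReal μ * volume (ocyl d s p.1 p.2) ≠ ⊤ :=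
      ENNReal.mul_ne_top ENNReal.ofReal_ne_top hfin
    exact le_of_eq ((ENNReal.add_left_inj hfin2).1 (hsplit.symm.trans hsum.symm))
  set G : Set (Phase d) := ⋃ p ∈ T, ocyl d s p.1 p.2 with hG
  have hGo : IsOpen G := isOpen_biUnion fun p _ => ocyl_open d s p.1 p.2
  have hGQ : G ⊆ unitCyl d s :=
    Set.iUnion₂_subset fun p hp => (ocyl_sub d s p.1 p.2).trans hp.2.1
  have hGf : volume G ≠ ⊤ :=
    ((measure_mono hGQ).trans_lt (by rw [hQv]; exact ENNReal.ofReal_lt_top)).ne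
  -- step 1 : the density gap
  have hvit := vitali d s hs T r₀ (fun p hp => ⟨hp.1, (hT p hp).2.le⟩) Eᶜ hE.compl
    (ENNReal.ofReal μ) (fun p hp => by rw [← Set.sdiff_eq]; exact hp.2.2.le)
  rw [← hG, ← Set.sdiff_eq] at hvit
  have hGE : volume (G ∩ E) ≤ ENNReal.ofReal B * volume G := by
    have hsum := measure_inter_add_sdiff (μ := volume) G hE
    have f1 : volume (G ∩ E) ≠ ⊤ := measure_ne_top_of_subset Set.inter_subset_left hGf
    have f2 : volume (G \ E) ≠ ⊤ := measure_ne_top_of_subset Set.sdiff_subset hGf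
    have hsumR := congrArg ENNReal.toReal hsum
    rw [ENNReal.toReal_add f1 f2] at hsumR
    have hvR := ENNReal.toReal_mono (ENNReal.mul_ne_top ENNReal.ofReal_ne_top f2) hvit
    rw [ENNReal.toReal_mul, ENNReal.toReal_mul, ENNReal.toReal_ofReal hμ.1.le,
      ENNReal.toReal_ofReal (by linarith)] at hvR
    rw [← ENNReal.ofReal_toReal f1, ← ENNReal.ofReal_toReal hGf, ← ENNReal.ofReal_mul (by linarith)]
    apply ENNReal.ofReal_le_ofReal
    have : 1 / Kc d * (μ * (volume G).toReal) ≤ (volume (G \ E)).toReal := by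
      rw [one_div, inv_mul_le_iff₀ (by linarith)]
      exact hvR
    rw [hB]
    linarith
  -- step 2 : delayed cylinders
  have hstack := stack_vol d s m (by linarith) T (fun p hp => hp.1)
    ((F ∩ unitCyl d s) ∪ leak d (m * ρ)) ((hF.inter (unit_meas d s)).union (leak_meas d _)) (by
      intro p hp z hz
      have h1 := (hT p hp).1 hz
      rcases stack_sub d s m r₀ hs hm hη hr₀1 p.1 p.2 hp.1 (hT p hp).2 hp.2.1 hz with h | h
      · exact Or.inl ⟨h1, h⟩
      · exact Or.inr h)
  rw [← hG] at hstack
  have hW : volume ((F ∩ unitCyl d s) ∪ leak d (m * ρ)) ≤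
      volume (F ∩ unitCyl d s) + ENNReal.ofReal (C₁ * (m * ρ)) :=
    (measure_union_le _ _).trans (add_le_add le_rfl (leak_vol d _ (by positivity) hη))
  -- step 3 : covering of E
  set N := {z : Phase d | z ∈ E ∧ ‖z.2.2‖ < 1 ∧ ∀ l, 0 < l → l ≤ r₀ →
      ENNReal.ofReal μ * volume (ocyl d s (zpath d s z l) l) ≤
        volume (ocyl d s (zpath d s z l) l \ E)} with hN
  have hN0 : volume N = 0 := density d s hs E hE hEf μ r₀ hμ hr₀
  have hcov : E ⊆ (G ∩ E) ∪ (N ∪ bdry d ρ) := by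
    intro z hz
    obtain ⟨q1, q2, q3, q4⟩ := (mem_unit d s z).1 (hEQ hz)
    by_cases ht1 : -1 + ρ < z.1
    swap
    · right; right; left
      refine ⟨⟨q1, not_lt.1 ht1⟩, ?_, ?_⟩
      · simpa using q4
      · simpa using q3
    by_cases ht2 : z.1 < -ρ
    swap
    · right; right; right; left
      refine ⟨⟨not_lt.1 ht2, q2⟩, ?_, ?_⟩
      · simpa using q4
      · simpa using q3
    by_cases hx : ‖z.2.1‖ < 1 - 2 * ρ
    swap
    · right; right; right; right
      refine ⟨⟨q1, q2⟩, ⟨?_, ?_⟩, ?_⟩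
      · simpa using q4
      · simpa using hx
      · simpa using q3
    by_cases hzN : z ∈ N
    · right; left; exact hzN
    left
    refine ⟨?_, hz⟩
    obtain ⟨l, hl0, hlQ, hlE⟩ := stopping d s hs E hE μ r₀ hμ hr₀ hr₀1 z ht1 ht2 hx q3
      (fun hsub hle => lt_irrefl _ (hyp _ r₀ hr₀ hsub hle).2)
      (fun hall => hzN ⟨hz, q3, hall⟩)
    exact Set.mem_biUnion (show (zpath d s z l, l) ∈ T from ⟨hl0, hlQ, hlE⟩)
      (zpath_mem d s z l hl0 q3)
  have hbd := bdry_vol d ρ hρ hρ4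
  calc volume E ≤ volume (G ∩ E) + (volume N + volume (bdry d ρ)) :=
        (measure_mono hcov).trans ((measure_union_le _ _).trans
          (add_le_add le_rfl (measure_union_le _ _)))
    _ ≤ ENNReal.ofReal B * (ENNReal.ofReal A * (volume (F ∩ unitCyl d s) +
          ENNReal.ofReal (C₁ * (m * ρ)))) + ENNReal.ofReal (C₂ * ρ) := by
        rw [hN0, zero_add]
        exact add_le_add (hGE.trans (mul_le_mul' le_rfl (hstack.trans (mul_le_mul' le_rfl hW)))) hbd
    _ ≤ ENNReal.ofReal (A * B) * (volume (F ∩ unitCyl d s) +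
          ENNReal.ofReal (C₁ * (m * ρ))) + ENNReal.ofReal (A * B) *
          ENNReal.ofReal (2 * C₂ * (m * ρ)) := by
        refine add_le_add (le_of_eq ?_) ?_
        · rw [← mul_assoc, ← ENNReal.ofReal_mul (by linarith), mul_comm B A]
        · rw [← ENNReal.ofReal_mul (by linarith)]
          apply ENNReal.ofReal_le_ofReal
          calc C₂ * ρ = 1 / 2 * (2 * C₂ * (1 * ρ)) := by ring
            _ ≤ A * B * (2 * C₂ * (m * ρ)) := by gcongr
    _ = ENNReal.ofReal (A * B) * (volume (F ∩ unitCyl d s) +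
          ENNReal.ofReal (C₁ * (m * ρ) + 2 * C₂ * (m * ρ))) := by
        rw [← mul_add, add_assoc, ← ENNReal.ofReal_add (by positivity) (by positivity)]
    _ ≤ _ := by
        refine mul_le_mul' le_rfl (add_le_add le_rfl (ENNReal.ofReal_le_ofReal ?_))
        have : 0 ≤ (8 * Vb d ^ 2 + 1) * (m * ρ) := by positivity
        nlinarith
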